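/- For every integer k ≥ 4 there exists a connected k-regular finite simple graph whose smallest adjacency eigenvalue equals α₁, the smallest real root of the polynomial x³ + 2x² − 2x − 2. -/

import Mathlib

open SimpleGraph Filter

attribute [local instance] Classical.propDecidable

lemma adjMatrix_isHermitian {V : Type} [Fintype V] [DecidableEq V] (G : SimpleGraph V)
    [DecidableRel G.Adj] : (G.adjMatrix ℝ).IsHermitian := by
  rw [Matrix.IsHermitian, Matrix.conjTranspose_eq_transpose_of_trivial]
  exact G.isSymm_adjMatrix

/-- The smallest eigenvalue of the (real) adjacency matrix of a finite simple graph. -/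
noncomputable def lambdaMin {V : Type} [Fintype V] (G : SimpleGraph V) : ℝ :=
  ⨅ i : V, (adjMatrix_isHermitian G).eigenvalues i

lemma lambdaMin_eq_sInf_spectrum {V : Type} [Fintype V] (G : SimpleGraph V) :
    lambdaMin G = sInf (spectrum ℝ (G.adjMatrix ℝ)) := by
  rw [(adjMatrix_isHermitian G).spectrum_real_eq_range_eigenvalues]
  rfl

lemma lambdaMin_congr {V W : Type} [Fintype V] [Fintype W] {G : SimpleGraph V}
    {H : SimpleGraph W} (e : G ≃g H) : lambdaMin G = lambdaMin H := by
  rw [lambdaMin_eq_sInf_spectrum, lambdaMin_eq_sInf_spectrum, ← e.reindex_adjMatrix ℝ,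
    ← AlgEquiv.spectrum_eq (Matrix.reindexAlgEquiv ℝ ℝ e.toEquiv) (G.adjMatrix ℝ)]
  rfl

lemma adjMatrix_mulVec_eq_sum_ite {V : Type} [Fintype V] (G : SimpleGraph V) (x : V → ℝ) (v : V) :
    (G.adjMatrix ℝ).mulVec x v = ∑ w, if G.Adj v w then x w else 0 := by
  simp [Matrix.mulVec, dotProduct, SimpleGraph.adjMatrix_apply]

lemma mem_spectrum_iff_exists_mulVec {V : Type} [Fintype V] (A : Matrix V V ℝ) (μ : ℝ) :
    μ ∈ spectrum ℝ A ↔ ∃ x ≠ 0, A.mulVec x = μ • x := by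
  rw [← Matrix.spectrum_toLin', ← Module.End.hasEigenvalue_iff_mem_spectrum]
  constructor
  · intro h
    obtain ⟨x, hx⟩ := h.exists_hasEigenvector
    exact ⟨x, hx.2, by simpa using hx.apply_eq_smul⟩
  · rintro ⟨x, hx, h⟩
    exact Module.End.hasEigenvalue_of_hasEigenvector (x := x)
      ⟨Module.End.mem_eigenspace_iff.2 (by simpa using h), hx⟩

/-- The variational criterion: a lower bound for the quadratic form that is attained by an
eigenvector is the smallest eigenvalue. -/
lemma lambdaMin_eq_of_quadratic_bound {V : Type} [Fintype V] (G : SimpleGraph V) (μ : ℝ)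
    (hbound : ∀ x : V → ℝ,
      μ * ∑ v, x v ^ 2 ≤ ∑ v, x v * ∑ w, if G.Adj v w then x w else 0)
    (y : V → ℝ) (hy : y ≠ 0) (hev : ∀ v, (∑ w, if G.Adj v w then y w else 0) = μ * y v) :
    lambdaMin G = μ := by
  rw [lambdaMin_eq_sInf_spectrum]
  refine IsLeast.csInf_eq ⟨?_, ?_⟩
  · rw [mem_spectrum_iff_exists_mulVec]
    exact ⟨y, hy, funext fun v => by
      rw [adjMatrix_mulVec_eq_sum_ite, hev, Pi.smul_apply, smul_eq_mul]⟩
  · intro ν hν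
    obtain ⟨x, hx, h⟩ := (mem_spectrum_iff_exists_mulVec _ _).1 hν
    have hpos : 0 < ∑ v, x v ^ 2 := by
      obtain ⟨v, hv⟩ := Function.ne_iff.1 hx
      exact Finset.sum_pos' (fun i _ => sq_nonneg _)
        ⟨v, Finset.mem_univ _, sq_pos_of_ne_zero hv⟩
    have hform := hbound x
    have hrow : ∀ v, (∑ w, if G.Adj v w then x w else 0) = ν * x v := fun v => by
      rw [← adjMatrix_mulVec_eq_sum_ite, h]; simp
    have hsum : (∑ v, x v * ∑ w, if G.Adj v w then x w else 0) = ν * ∑ v, x v ^ 2 := by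
      rw [Finset.mul_sum]
      exact Finset.sum_congr rfl fun v _ => by rw [hrow]; ring
    rw [hsum] at hform
    exact le_of_mul_le_mul_right hform hpos

/-- Copies of `H` indexed by `P`, in which the copies of a vertex `t` with the same label under
`π t` are joined into a clique. -/
def gluedCopies {P T C : Type} (H : SimpleGraph T) (π : T → P → C) : SimpleGraph (P × T) where
  Adj v w := (v.1 = w.1 ∧ H.Adj v.2 w.2) ∨ (v.1 ≠ w.1 ∧ v.2 = w.2 ∧ π v.2 v.1 = π v.2 w.1)
  symm := ⟨by
    rintro v w (⟨h, h'⟩ | ⟨h, h', h''⟩)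
    · exact Or.inl ⟨h.symm, h'.symm⟩
    · exact Or.inr ⟨h.symm, h'.symm, by rw [← h', h'']⟩⟩
  loopless := ⟨by
    rintro v (⟨-, h⟩ | ⟨h, -⟩)
    · exact h.ne rfl
    · exact h rfl⟩

section GluedCopies

variable {P T C : Type} (H : SimpleGraph T) (π : T → P → C)

lemma gluedCopies_sum_adj [Fintype P] [Fintype T] {R : Type} [CommSemiring R]
    (f : P × T → R) (p : P) (t : T) :
    (∑ w, if (gluedCopies H π).Adj (p, t) w then f w else 0) + f (p, t) =
      (∑ s, if H.Adj t s then f (p, s) else 0) +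
        ∑ q, if π t p = π t q then f (q, t) else 0 := by
  have hself : f (p, t) = ∑ w, if w = (p, t) then f w else 0 := by simp
  have hcopy : (∑ s, if H.Adj t s then f (p, s) else 0) =
      ∑ w : P × T, if p = w.1 ∧ H.Adj t w.2 then f w else 0 := by
    simp [Fintype.sum_prod_type, ite_and]
  have hclique : (∑ q, if π t p = π t q then f (q, t) else 0) =
      ∑ w : P × T, if t = w.2 ∧ π t p = π t w.1 then f w else 0 := by
    simp [Fintype.sum_prod_type, ite_and]
  rw [hcopy, hclique, hself, ← Finset.sum_add_distrib, ← Finset.sum_add_distrib]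
  refine Finset.sum_congr rfl ?_
  rintro ⟨q, s⟩ -
  by_cases hpq : p = q <;> by_cases hts : t = s
  · subst hpq hts
    simp [gluedCopies]
  · subst hpq
    simp [gluedCopies, hts, Ne.symm hts]
  · subst hts
    simp [gluedCopies, hpq, Ne.symm hpq]
  · simp [gluedCopies, hpq, hts, Ne.symm hpq]

lemma sum_mul_sum_fiber_nonneg [Fintype P] (g : P → C) (a : P → ℝ) :
    0 ≤ ∑ p, a p * ∑ q, if g p = g q then a q else 0 := by
  have hfib : ∀ p, (a p * ∑ q, if g p = g q then a q else 0) =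
      ∑ c ∈ Finset.univ.image g, (if g p = c then a p else 0) * ∑ q, if g q = c then a q else 0 := by
    intro p
    rw [Finset.sum_eq_single_of_mem (g p) (Finset.mem_image_of_mem g (Finset.mem_univ p))]
    · simp [eq_comm]
    · intro c _ hc
      simp [hc.symm]
  rw [Finset.sum_congr rfl fun p _ => hfib p, Finset.sum_comm]
  refine Finset.sum_nonneg fun c _ => ?_
  rw [← Finset.sum_mul]
  exact mul_self_nonneg _

lemma gluedCopies_quadratic_bound [Fintype P] [Fintype T] (β : ℝ)
    (hH : ∀ x : T → ℝ, β * ∑ t, x t ^ 2 ≤ ∑ t, x t * ∑ s, if H.Adj t s then x s else 0)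
    (x : P × T → ℝ) :
    (β - 1) * ∑ v, x v ^ 2 ≤
      ∑ v, x v * ∑ w, if (gluedCopies H π).Adj v w then x w else 0 := by
  have hrow : ∀ p t, (x (p, t) * ∑ w, if (gluedCopies H π).Adj (p, t) w then x w else 0) =
      x (p, t) * (∑ s, if H.Adj t s then x (p, s) else 0) +
        x (p, t) * (∑ q, if π t p = π t q then x (q, t) else 0) - x (p, t) ^ 2 := fun p t => by
    rw [eq_sub_of_add_eq (gluedCopies_sum_adj H π x p t)]; ring
  simp only [Fintype.sum_prod_type] at hrow ⊢
  simp only [hrow, Finset.sum_sub_distrib, Finset.sum_add_distrib]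
  have hcopies : β * ∑ p, ∑ t, x (p, t) ^ 2 ≤
      ∑ p, ∑ t, x (p, t) * ∑ s, if H.Adj t s then x (p, s) else 0 := by
    rw [Finset.mul_sum]
    exact Finset.sum_le_sum fun p _ => hH fun t => x (p, t)
  have hcliques : 0 ≤ ∑ p, ∑ t, x (p, t) * ∑ q, if π t p = π t q then x (q, t) else 0 := by
    rw [Finset.sum_comm]
    exact Finset.sum_nonneg fun t _ => sum_mul_sum_fiber_nonneg (π t) fun p => x (p, t)
  linarith

lemma gluedCopies_eigenvector [Fintype P] [Fintype T] (β : ℝ) (w : T → ℝ)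
    (hw : ∀ t, (∑ s, if H.Adj t s then w s else 0) = β * w t) (g : P → ℝ)
    (hg : ∀ t p, (∑ q, if π t p = π t q then g q else 0) = 0) (v : P × T) :
    (∑ u, if (gluedCopies H π).Adj v u then g u.1 * w u.2 else 0) =
      (β - 1) * (g v.1 * w v.2) := by
  obtain ⟨p, t⟩ := v
  have hcopy : (∑ s, if H.Adj t s then g p * w s else 0) = g p * (β * w t) := by
    rw [← hw, Finset.mul_sum]; simp
  have hclique : (∑ q, if π t p = π t q then g q * w t else 0) = 0 := by
    calc _ = (∑ q, if π t p = π t q then g q else 0) * w t := by rw [Finset.sum_mul]; simp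
      _ = 0 := by rw [hg, zero_mul]
  have h := gluedCopies_sum_adj H π (fun u => g u.1 * w u.2) p t
  simp only [hcopy, hclique] at h
  linear_combination h

lemma gluedCopies_degree_add_one [Fintype P] [Fintype T] (p : P) (t : T) :
    (gluedCopies H π).degree (p, t) + 1 =
      H.degree t + ∑ q, if π t p = π t q then 1 else 0 := by
  have h := gluedCopies_sum_adj H π (fun _ => (1 : ℕ)) p t
  have hdeg := degree_eq_sum_if_adj (gluedCopies H π) (R := ℕ) (p, t)
  have hdeg' := degree_eq_sum_if_adj H (R := ℕ) t
  simp only [Nat.cast_id] at hdeg hdeg'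
  rw [← hdeg, ← hdeg'] at h
  exact h

variable {H π}

lemma gluedCopies_reachable_copy (hH : H.Connected) (p : P) (s t : T) :
    (gluedCopies H π).Reachable (p, s) (p, t) :=
  (hH.preconnected s t).map (G' := gluedCopies H π) ⟨fun t => (p, t), fun h => Or.inl ⟨rfl, h⟩⟩

lemma gluedCopies_reachable_fiber (hH : H.Connected) (t : T) {p q : P} (h : π t p = π t q)
    (s : T) : (gluedCopies H π).Reachable (p, s) (q, s) := by
  by_cases hpq : p = q
  · rw [hpq]
  · have hadj : (gluedCopies H π).Adj (p, t) (q, t) := Or.inr ⟨hpq, rfl, h⟩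
    exact ((gluedCopies_reachable_copy hH p s t).trans hadj.reachable).trans
      (gluedCopies_reachable_copy hH q t s)

end GluedCopies

/-- The paw: the triangle `0, 1, 2` with the pendant vertex `3` attached to `0`. -/
def paw : SimpleGraph (Fin 4) where
  Adj s t := s ≠ t ∧ (s = 0 ∨ t = 0 ∨ (s ≠ 3 ∧ t ≠ 3))
  symm := ⟨by rintro s t ⟨h, h'⟩; exact ⟨h.symm, by tauto⟩⟩
  loopless := ⟨fun s h => h.1 rfl⟩

lemma paw_connected : paw.Connected := by
  rw [connected_iff_exists_forall_reachable]
  refine ⟨0, fun t => ?_⟩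
  by_cases ht : 0 = t
  · rw [ht]
  · exact Adj.reachable ⟨ht, Or.inl rfl⟩

lemma paw_sum_adj (x : Fin 4 → ℝ) (t : Fin 4) :
    (∑ s, if paw.Adj t s then x s else 0) =
      ![x 1 + x 2 + x 3, x 0 + x 2, x 0 + x 1, x 0] t := by
  fin_cases t <;> simp [Fin.sum_univ_four, paw]

lemma paw_degree (t : Fin 4) : paw.degree t = ![3, 2, 2, 1] t := by
  have h := degree_eq_sum_if_adj paw (R := ℕ) t
  rw [Nat.cast_id] at h
  rw [h, Fin.sum_univ_four]
  fin_cases t <;> simp [paw]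

lemma paw_quadratic_bound {c : ℝ} (hc : 1 < c) (hroot : c ^ 3 + c ^ 2 - 3 * c - 1 = 0)
    (x : Fin 4 → ℝ) :
    -c * ∑ t, x t ^ 2 ≤ ∑ t, x t * ∑ s, if paw.Adj t s then x s else 0 := by
  simp only [paw_sum_adj]
  simp only [Fin.sum_univ_four]
  have hc0 : c ≠ 0 := by positivity
  have hc1 : c + 1 ≠ 0 := by positivity
  have hsos : c * (x 0 ^ 2 + x 1 ^ 2 + x 2 ^ 2 + x 3 ^ 2) +
      2 * (x 0 * x 1 + x 0 * x 2 + x 0 * x 3 + x 1 * x 2) =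
      (c * x 3 + x 0) ^ 2 / c + ((c + 1) * (x 1 + x 2) + 2 * x 0) ^ 2 / (2 * (c + 1)) +
        (c - 1) / 2 * (x 1 - x 2) ^ 2 := by
    field_simp
    linear_combination (2 * x 0 ^ 2) * hroot
  have h1 : 0 ≤ (c * x 3 + x 0) ^ 2 / c := by positivity
  have h2 : 0 ≤ ((c + 1) * (x 1 + x 2) + 2 * x 0) ^ 2 / (2 * (c + 1)) := by positivity
  have h3 : 0 ≤ (c - 1) / 2 * (x 1 - x 2) ^ 2 :=
    mul_nonneg (by linarith) (sq_nonneg _)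
  simp
  nlinarith

lemma paw_eigenvector {c : ℝ} (hroot : c ^ 3 + c ^ 2 - 3 * c - 1 = 0) (t : Fin 4) :
    (∑ s, if paw.Adj t s then ![c * (c + 1), -c, -c, -(c + 1)] s else 0) =
      -c * ![c * (c + 1), -c, -c, -(c + 1)] t := by
  rw [paw_sum_adj]
  fin_cases t <;> simp <;> first | ring1 | linear_combination hroot

/-- Labels of a point of a box whose fibers are the lines in the direction assigned to `t`: the
first coordinate for `0`, the second for `1` and `2`, the third for `3`. -/
def boxLine (a b c : ℕ) [NeZero a] [NeZero b] [NeZero c] (t : Fin 4)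
    (p : Fin a × Fin b × Fin c) : Fin a × Fin b × Fin c :=
  ![(0, p.2.1, p.2.2), (p.1, 0, p.2.2), (p.1, 0, p.2.2), (p.1, p.2.1, 0)] t

section Box

variable (a b c : ℕ) [NeZero a] [NeZero b] [NeZero c]

lemma boxLine_sum_fiber {R : Type} [CommSemiring R] (f : Fin a × Fin b × Fin c → R)
    (t : Fin 4) (p : Fin a × Fin b × Fin c)
    {_ : ∀ q, Decidable (boxLine a b c t p = boxLine a b c t q)} :
    (∑ q, if boxLine a b c t p = boxLine a b c t q then f q else 0) =
      ![∑ i, f (i, p.2), ∑ j, f (p.1, j, p.2.2), ∑ j, f (p.1, j, p.2.2),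
        ∑ l, f (p.1, p.2.1, l)] t := by
  fin_cases t <;> simp [boxLine, Fintype.sum_prod_type, ite_and, Prod.ext_iff]
  rw [Finset.sum_comm]
  simp

lemma gluedCopies_boxLine_connected :
    (gluedCopies paw (boxLine a b c)).Connected := by
  rw [connected_iff_exists_forall_reachable]
  refine ⟨((0, 0, 0), 0), ?_⟩
  rintro ⟨⟨i, j, l⟩, t⟩
  have h0 : (gluedCopies paw (boxLine a b c)).Reachable ((0, 0, 0), 0) ((i, 0, 0), 0) :=
    gluedCopies_reachable_fiber paw_connected 0 (by simp [boxLine]) 0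
  have h1 : (gluedCopies paw (boxLine a b c)).Reachable ((i, 0, 0), 0) ((i, j, 0), 0) :=
    gluedCopies_reachable_fiber paw_connected 1 (by simp [boxLine]) 0
  have h2 : (gluedCopies paw (boxLine a b c)).Reachable ((i, j, 0), 0) ((i, j, l), 0) :=
    gluedCopies_reachable_fiber paw_connected 3 (by simp [boxLine]) 0
  exact ((h0.trans h1).trans h2).trans (gluedCopies_reachable_copy paw_connected _ 0 t)

end Box

lemma gluedCopies_boxLine_isRegularOfDegree (m : ℕ) :
    (gluedCopies paw (boxLine (m + 2) (m + 3) (m + 4))).IsRegularOfDegree (m + 4) := by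
  rintro ⟨p, t⟩
  have h := gluedCopies_degree_add_one paw (boxLine (m + 2) (m + 3) (m + 4)) p t
  rw [paw_degree] at h
  replace h := h.trans (congrArg _ (boxLine_sum_fiber _ _ _ (fun _ => (1 : ℕ)) t p))
  fin_cases t <;> simp at h ⊢ <;> omega

lemma exists_sum_eq_zero_ne_zero (n : ℕ) : ∃ h : Fin (n + 2) → ℝ, h 0 ≠ 0 ∧ ∑ i, h i = 0 :=
  ⟨Pi.single 0 1 - Pi.single 1 1, by simp, by simp⟩

lemma lambdaMin_gluedCopies_boxLine (m : ℕ) {c : ℝ} (hc : 1 < c)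
    (hroot : c ^ 3 + c ^ 2 - 3 * c - 1 = 0) :
    lambdaMin (gluedCopies paw (boxLine (m + 2) (m + 3) (m + 4))) = -c - 1 := by
  obtain ⟨h₁, h₁0, h₁s⟩ := exists_sum_eq_zero_ne_zero m
  obtain ⟨h₂, h₂0, h₂s⟩ := exists_sum_eq_zero_ne_zero (m + 1)
  obtain ⟨h₃, h₃0, h₃s⟩ := exists_sum_eq_zero_ne_zero (m + 2)
  refine lambdaMin_eq_of_quadratic_bound _ _
    (gluedCopies_quadratic_bound _ _ _ (paw_quadratic_bound hc hroot)) _ ?_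
    (gluedCopies_eigenvector _ _ _ _ (paw_eigenvector hroot)
      (fun p => h₁ p.1 * h₂ p.2.1 * h₃ p.2.2) fun t p => ?_)
  · refine Function.ne_iff.2 ⟨((0, 0, 0), 1), ?_⟩
    simp [h₁0, h₂0, h₃0]
    positivity
  · refine (boxLine_sum_fiber _ _ _ (fun p => h₁ p.1 * h₂ p.2.1 * h₃ p.2.2) t p).trans ?_
    fin_cases t <;> simp [← Finset.sum_mul, ← Finset.mul_sum, h₁s, h₂s, h₃s]

lemma lt_neg_two_of_isLeast {α : ℝ}
    (hα : IsLeast {x : ℝ | x ^ 3 + 2 * x ^ 2 - 2 * x - 2 = 0} α) : α < -2 := by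
  have hcont : ContinuousOn (fun x : ℝ => x ^ 3 + 2 * x ^ 2 - 2 * x - 2) (Set.Icc (-3) (-2)) := by
    fun_prop
  obtain ⟨x, hx, hx0⟩ := intermediate_value_Ioo (by norm_num) hcont
    (show (0 : ℝ) ∈ _ by constructor <;> norm_num)
  exact (hα.2 hx0).trans_lt hx.2

/-- For every `k ≥ 4` there is a connected `k`-regular graph with smallest adjacency
eigenvalue exactly `α₁`, the smallest real root of `x³+2x²-2x-2`. -/
theorem stmt_13 (α₁ : ℝ) (hα₁ : IsLeast {x : ℝ | x ^ 3 + 2 * x ^ 2 - 2 * x - 2 = 0} α₁)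
    (k : ℕ) (hk : 4 ≤ k) :
    ∃ (n : ℕ) (G : SimpleGraph (Fin n)), G.Connected ∧ G.IsRegularOfDegree k ∧
      lambdaMin G = α₁ := by
  obtain ⟨m, rfl⟩ := Nat.exists_eq_add_of_le' hk
  have hα := lt_neg_two_of_isLeast hα₁
  have hroot : α₁ ^ 3 + 2 * α₁ ^ 2 - 2 * α₁ - 2 = 0 := hα₁.1
  let G := gluedCopies paw (boxLine (m + 2) (m + 3) (m + 4))
  let e := G.overFinIso rfl
  refine ⟨_, G.overFin rfl, e.connected_iff.1 (gluedCopies_boxLine_connected _ _ _),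
    fun v => ?_, ?_⟩
  · rw [← e.symm.degree_eq v]
    exact gluedCopies_boxLine_isRegularOfDegree m _
  · rw [← lambdaMin_congr e, lambdaMin_gluedCopies_boxLine m (c := -α₁ - 1) (by linarith)
      (by linear_combination -hroot)]
    ring
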